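/- arXiv:2212.07383 — 6 statements merged into one kernel-verified Lean document; each statement's English description precedes it below -/
import Mathlib

section
/- Let X₁, X₂ be random variables with values in a measurable space 𝒳 and Y₁, Y₂ be random variables with values in a measurable space 𝒴, defined on a common probability space, such that the pair (X₁,X₂) is independent of the pair (Y₁,Y₂). Assume moreover that X₁ and X₂ are identically distributed, or Y₁ and Y₂ are identically distributed. Then for all bounded measurable functions g : 𝒳 → ℝ and h : 𝒴 → ℝ, E[(g(X₂) − g(X₁))(h(Y₂) − h(Y₁))] = 0. (Zero-mean property of the payoff under the time-varying independence null with distribution drift, Theorem 1, part 1, drift case.) -/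
open MeasureTheory ProbabilityTheory

/-- A bounded measurable function has increments of mean zero between two identically
distributed random variables. -/
theorem integral_sub_comp_eq_zero_of_map_eq {Ω E : Type*} [MeasurableSpace Ω]
    [MeasurableSpace E] {P : Measure Ω} [IsFiniteMeasure P] {Z₁ Z₂ : Ω → E}
    (hZ₁ : Measurable Z₁) (hZ₂ : Measurable Z₂) (hmap : P.map Z₁ = P.map Z₂)
    {f : E → ℝ} (hf : Measurable f) {C : ℝ} (hC : ∀ z, |f z| ≤ C) :
    ∫ ω, (f (Z₂ ω) - f (Z₁ ω)) ∂P = 0 := by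
  have hint {Z : Ω → E} (hZ : Measurable Z) : Integrable (fun ω => f (Z ω)) P :=
    .of_bound (hf.comp hZ).aestronglyMeasurable C (.of_forall fun ω => hC (Z ω))
  have hident : IdentDistrib Z₁ Z₂ P P := ⟨hZ₁.aemeasurable, hZ₂.aemeasurable, hmap⟩
  rw [integral_sub (hint hZ₂) (hint hZ₁), sub_eq_zero]
  exact (hident.comp hf).integral_eq.symm

/-- Zero-mean property of the payoff under the time-varying independence null with
distribution drift (Theorem 1, part 1, drift case): if `(X₁,X₂) ⟂ (Y₁,Y₂)` and either
`X₁ =d X₂` or `Y₁ =d Y₂`, then for all bounded measurable `g`, `h`,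
`E[(g(X₂) − g(X₁))(h(Y₂) − h(Y₁))] = 0`. -/
theorem stmt1
    {Ω 𝒳 𝒴 : Type*} [MeasurableSpace Ω] [MeasurableSpace 𝒳] [MeasurableSpace 𝒴]
    (P : Measure Ω) [IsProbabilityMeasure P]
    (X₁ X₂ : Ω → 𝒳) (Y₁ Y₂ : Ω → 𝒴)
    (hX₁ : Measurable X₁) (hX₂ : Measurable X₂)
    (hY₁ : Measurable Y₁) (hY₂ : Measurable Y₂)
    (hindep : IndepFun (fun ω => (X₁ ω, X₂ ω)) (fun ω => (Y₁ ω, Y₂ ω)) P)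
    (hident : P.map X₁ = P.map X₂ ∨ P.map Y₁ = P.map Y₂) :
    ∀ (g : 𝒳 → ℝ) (h : 𝒴 → ℝ), Measurable g → Measurable h →
      (∃ Cg, ∀ x, |g x| ≤ Cg) → (∃ Ch, ∀ y, |h y| ≤ Ch) →
      ∫ ω, (g (X₂ ω) - g (X₁ ω)) * (h (Y₂ ω) - h (Y₁ ω)) ∂P = 0 := by
  rintro g h hg hh ⟨Cg, hCg⟩ ⟨Ch, hCh⟩
  have hincr : IndepFun (fun ω => g (X₂ ω) - g (X₁ ω)) (fun ω => h (Y₂ ω) - h (Y₁ ω)) P :=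
    hindep.comp (φ := fun p : 𝒳 × 𝒳 => g p.2 - g p.1) (ψ := fun p : 𝒴 × 𝒴 => h p.2 - h p.1)
      (by fun_prop) (by fun_prop)
  rw [hincr.integral_fun_mul_eq_mul_integral (by fun_prop) (by fun_prop)]
  rcases hident with hX | hY
  · rw [integral_sub_comp_eq_zero_of_map_eq hX₁ hX₂ hX hg hCg, zero_mul]
  · rw [integral_sub_comp_eq_zero_of_map_eq hY₁ hY₂ hY hh hCh, mul_zero]
end

section
/- Let W be a real-valued random variable on a probability space with −1 ≤ W ≤ 1 almost surely and E[W] > 0. Define λ* = E[W] / (E[W] + E[W²]). Then λ* ∈ (0,1) and E[log(1 + λ*W)] ≥ (E[W])² / (2(E[W] + E[W²])) > 0. (Positive expected log-wealth of the oracle betting fraction, from the proof of Theorem 1, part 2.) -/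
open MeasureTheory ProbabilityTheory

/-- Fan's inequality for the logarithm, on the symmetric interval `[-1, 1]`. -/
theorem fan_le_log_one_add_mul {l w : ℝ} (hl : 0 ≤ l) (hl1 : l < 1)
    (hw : w ∈ Set.Icc (-1 : ℝ) 1) :
    l * w + w ^ 2 * (Real.log (1 - l) + l) ≤ Real.log (1 + l * w) := by
  have hw' : |w| ≤ 1 := abs_le.mpr hw
  have hlw : |l * -w| < 1 := by
    rw [abs_mul, abs_neg, abs_of_nonneg hl]
    exact (mul_le_of_le_one_right hl hw').trans_lt hl1
  have hlog := Real.hasSum_pow_div_log_of_abs_lt_one hlw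
  have hbound := ((Real.hasSum_pow_div_log_of_abs_lt_one
    (by rwa [abs_of_nonneg hl] : |l| < 1)).mul_left (w ^ 2)).add
    (hasSum_ite_eq 0 (l * -w - w ^ 2 * l))
  have hle := hasSum_le (fun n => ?_) hlog hbound
  · rw [show 1 - l * -w = 1 + l * w by ring] at hle
    linarith
  · rcases n with _ | n
    · simp
    · have hpow : (-w) ^ (n + 1 + 1) ≤ w ^ 2 := by
        refine (le_abs_self _).trans ?_
        rw [abs_pow, abs_neg, ← sq_abs w]
        exact pow_le_pow_of_le_one (abs_nonneg w) hw' (by omega)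
      rw [if_neg (Nat.succ_ne_zero n), add_zero, mul_pow, ← mul_div_assoc, mul_comm (w ^ 2)]
      gcongr

/-- `log y` is at most `sinh (log y) = (y - y⁻¹) / 2` for `y ≥ 1`. -/
theorem log_le_half_sub_inv {y : ℝ} (hy : 1 ≤ y) : Real.log y ≤ (y - y⁻¹) / 2 := by
  rw [← Real.sinh_log (by linarith)]
  exact Real.self_le_sinh_iff.mpr (Real.log_nonneg hy)

/-- The lower bound obtained by averaging Fan's inequality at the fraction `a / (a + b)`. -/
theorem sq_div_le_fan_average {a b : ℝ} (ha : 0 < a) (hb : 0 < b) :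
    a ^ 2 / (2 * (a + b)) ≤
      a / (a + b) * a + b * (Real.log (1 - a / (a + b)) + a / (a + b)) := by
  have hlog := log_le_half_sub_inv (y := (a + b) / b) (by rw [le_div_iff₀ hb]; linarith)
  have hfrac : 1 - a / (a + b) = ((a + b) / b)⁻¹ := by field_simp; ring
  rw [hfrac, Real.log_inv]
  have hmul := mul_le_mul_of_nonneg_left hlog hb.le
  have hid : a / (a + b) * a + b * (a / (a + b)) - b * (((a + b) / b - ((a + b) / b)⁻¹) / 2)
      = a ^ 2 / (2 * (a + b)) := by field_simp; ring
  linarith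

/-- Positive expected log-wealth of the oracle betting fraction
(from the proof of Theorem 1, part 2): if `−1 ≤ W ≤ 1` a.s. and `E[W] > 0`, then
`λ* = E[W]/(E[W]+E[W²]) ∈ (0,1)` and
`E[log(1 + λ*·W)] ≥ (E[W])²/(2(E[W]+E[W²])) > 0`. -/
theorem stmt2
    {Ω : Type*} [MeasurableSpace Ω] (P : Measure Ω) [IsProbabilityMeasure P]
    (W : Ω → ℝ) (hW : Measurable W)
    (hbdd : ∀ᵐ ω ∂P, W ω ∈ Set.Icc (-1 : ℝ) 1)
    (hpos : 0 < ∫ ω, W ω ∂P) :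
    (0 < (∫ ω, W ω ∂P) / ((∫ ω, W ω ∂P) + ∫ ω, (W ω) ^ 2 ∂P)) ∧
    ((∫ ω, W ω ∂P) / ((∫ ω, W ω ∂P) + ∫ ω, (W ω) ^ 2 ∂P) < 1) ∧
    ((∫ ω, W ω ∂P) ^ 2 / (2 * ((∫ ω, W ω ∂P) + ∫ ω, (W ω) ^ 2 ∂P)) ≤
      ∫ ω, Real.log (1 +
        ((∫ ω', W ω' ∂P) / ((∫ ω', W ω' ∂P) + ∫ ω', (W ω') ^ 2 ∂P)) * W ω) ∂P) ∧
    (0 < (∫ ω, W ω ∂P) ^ 2 / (2 * ((∫ ω, W ω ∂P) + ∫ ω, (W ω) ^ 2 ∂P))) := by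
  have hint : Integrable W P := Integrable.of_mem_Icc (-1) 1 hW.aemeasurable hbdd
  have hint2 : Integrable (fun ω => W ω ^ 2) P := by
    refine Integrable.of_mem_Icc 0 1 (hW.pow_const 2).aemeasurable ?_
    filter_upwards [hbdd] with ω hω
    exact ⟨sq_nonneg _, (sq_le_one_iff_abs_le_one _).mpr (abs_le.mpr hω)⟩
  have hsq : 0 < ∫ ω, W ω ^ 2 ∂P := by
    refine (integral_nonneg fun ω => sq_nonneg (W ω)).lt_of_ne' fun h => hpos.ne' ?_
    rw [integral_eq_zero_iff_of_nonneg (fun ω => sq_nonneg (W ω)) hint2] at h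
    refine integral_eq_zero_of_ae ?_
    filter_upwards [h] with ω hω
    exact pow_eq_zero_iff two_ne_zero |>.mp hω
  set a := ∫ ω, W ω ∂P
  set b := ∫ ω, W ω ^ 2 ∂P
  have hl : 0 < a / (a + b) := by positivity
  have hl1 : a / (a + b) < 1 := by rw [div_lt_one (by positivity)]; linarith
  refine ⟨hl, hl1, (sq_div_le_fan_average hpos hsq).trans ?_, by positivity⟩
  set l := a / (a + b)
  have hlog : Integrable (fun ω => Real.log (1 + l * W ω)) P := by
    refine Integrable.of_mem_Icc (Real.log (1 - l)) (Real.log (1 + l))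
      (Real.measurable_log.comp ((hW.const_mul l).const_add 1)).aemeasurable ?_
    filter_upwards [hbdd] with ω hω
    have hlower : 1 - l ≤ 1 + l * W ω := by nlinarith [hω.1]
    exact ⟨Real.log_le_log (by linarith) hlower,
      Real.log_le_log (by linarith) (by nlinarith [hω.2])⟩
  calc l * a + b * (Real.log (1 - l) + l)
      = ∫ ω, (l * W ω + W ω ^ 2 * (Real.log (1 - l) + l)) ∂P := by
        rw [integral_add (hint.const_mul l) (hint2.mul_const _), integral_const_mul,
          integral_mul_const]
    _ ≤ ∫ ω, Real.log (1 + l * W ω) ∂P := by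
        refine integral_mono_ae ((hint.const_mul l).add (hint2.mul_const _)) hlog ?_
        filter_upwards [hbdd] with ω hω
        exact fan_le_log_one_add_mul hl.le hl1 hω
end

section
/- Let W be a real-valued random variable with −1 ≤ W ≤ 1 almost surely, E[W] ≥ 0, and E[W²] > 0. Then for every λ ∈ [−1/2, 1/2], E[log(1 + λW)] ≤ (E[W]/2) · min( 8·E[W] / (3·E[W²]), 1 ). In particular the optimal log-wealth S* = sup_{λ ∈ [−1/2,1/2]} E[log(1 + λW)] satisfies S* ≤ (E[W]/2) · min( 8·E[W] / (3·E[W²]), 1 ). (Proposition 2, upper bound on the oracle growth rate.) -/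
open MeasureTheory ProbabilityTheory

theorem Real.log_one_add_le_sub_sq {x : ℝ} (hx : x ∈ Set.Icc (-(1 / 2) : ℝ) (1 / 2)) :
    Real.log (1 + x) ≤ x - 3 / 16 * x ^ 2 := by
  obtain ⟨h1, h2⟩ := hx
  have hpos : 0 < 1 + x := by linarith
  set s := √(1 + x) with hs
  have hs0 : 0 < s := Real.sqrt_pos.2 hpos
  have hss : s ^ 2 = 1 + x := Real.sq_sqrt hpos.le
  have hlog : Real.log (1 + x) ≤ 2 * (s - 1) := by
    rw [← hss, Real.log_pow]
    have := Real.log_le_sub_one_of_pos hs0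
    push_cast
    linarith
  have hs13 : s ≤ 13 / 10 := by nlinarith
  have hxs : x = s ^ 2 - 1 := by linarith
  have key : 0 ≤ (s - 1) ^ 2 * (16 / 3 - (s + 1) ^ 2) :=
    mul_nonneg (sq_nonneg _) (by nlinarith)
  have : 2 * (s - 1) ≤ x - 3 / 16 * x ^ 2 := by
    rw [hxs]
    nlinarith
  linarith

theorem Real.abs_log_one_add_le_one {x : ℝ} (hx : x ∈ Set.Icc (-(1 / 2) : ℝ) (1 / 2)) :
    |Real.log (1 + x)| ≤ 1 := by
  obtain ⟨h1, h2⟩ := hx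
  have hpos : 0 < 1 + x := by linarith
  have hupper := Real.log_le_sub_one_of_pos hpos
  have hlower := Real.one_sub_inv_le_log_of_pos hpos
  have hinv : (1 + x)⁻¹ ≤ 2 := by
    rw [inv_le_comm₀ hpos two_pos]
    linarith
  exact abs_le.2 ⟨by linarith, by linarith⟩

section LogWealth

variable {Ω : Type*} [MeasurableSpace Ω] {P : Measure Ω}
  {W : Ω → ℝ} {lam : ℝ}

theorem ae_mul_mem_Icc_half (hbdd : ∀ᵐ ω ∂P, W ω ∈ Set.Icc (-1 : ℝ) 1)
    (hlam : lam ∈ Set.Icc (-(1 / 2) : ℝ) (1 / 2)) :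
    ∀ᵐ ω ∂P, lam * W ω ∈ Set.Icc (-(1 / 2) : ℝ) (1 / 2) := by
  filter_upwards [hbdd] with ω hω
  rw [Set.mem_Icc, ← abs_le] at hω hlam ⊢
  rw [abs_mul]
  nlinarith [abs_nonneg lam, abs_nonneg (W ω)]

/-- A second-order bound on the expected log-wealth of a constant betting fraction. -/
theorem integral_log_one_add_mul_le [IsProbabilityMeasure P] (hW : Measurable W)
    (hbdd : ∀ᵐ ω ∂P, W ω ∈ Set.Icc (-1 : ℝ) 1)
    (hlam : lam ∈ Set.Icc (-(1 / 2) : ℝ) (1 / 2)) :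
    ∫ ω, Real.log (1 + lam * W ω) ∂P ≤
      lam * ∫ ω, W ω ∂P - 3 / 16 * lam ^ 2 * ∫ ω, (W ω) ^ 2 ∂P := by
  have hrange := ae_mul_mem_Icc_half hbdd hlam
  have hint : Integrable W P := by
    refine Integrable.of_bound hW.aestronglyMeasurable 1 ?_
    filter_upwards [hbdd] with ω hω using abs_le.2 hω
  have hint2 : Integrable (fun ω => (W ω) ^ 2) P := by
    refine Integrable.of_bound (hW.pow_const 2).aestronglyMeasurable 1 ?_
    filter_upwards [hbdd] with ω hω
    rw [Real.norm_of_nonneg (sq_nonneg _)]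
    exact (sq_le_one_iff_abs_le_one _).2 (abs_le.2 hω)
  have hintlog : Integrable (fun ω => Real.log (1 + lam * W ω)) P := by
    refine Integrable.of_bound
      (Real.measurable_log.comp ((hW.const_mul lam).const_add 1)).aestronglyMeasurable 1 ?_
    filter_upwards [hrange] with ω hω using Real.abs_log_one_add_le_one hω
  rw [← integral_const_mul, ← integral_const_mul,
    ← integral_sub (hint.const_mul _) (hint2.const_mul _)]
  refine integral_mono_ae hintlog ((hint.const_mul _).sub (hint2.const_mul _)) ?_
  filter_upwards [hrange] with ω hω
  have := Real.log_one_add_le_sub_sq hω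
  linarith

end LogWealth

/-- Proposition 2 (upper bound on the oracle growth rate): if `−1 ≤ W ≤ 1` a.s.,
`E[W] ≥ 0` and `E[W²] > 0`, then for every `λ ∈ [−1/2, 1/2]`,
`E[log(1 + λW)] ≤ (E[W]/2)·min(8E[W]/(3E[W²]), 1)`; in particular the optimal log-wealth
`S* = sup_{λ ∈ [−1/2,1/2]} E[log(1 + λW)]` satisfies the same bound. -/
theorem stmt4
    {Ω : Type*} [MeasurableSpace Ω] (P : Measure Ω) [IsProbabilityMeasure P]
    (W : Ω → ℝ) (hW : Measurable W)
    (hbdd : ∀ᵐ ω ∂P, W ω ∈ Set.Icc (-1 : ℝ) 1)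
    (hmean : 0 ≤ ∫ ω, W ω ∂P) (hsq : 0 < ∫ ω, (W ω) ^ 2 ∂P) :
    (∀ lam ∈ Set.Icc (-(1 / 2) : ℝ) (1 / 2),
      ∫ ω, Real.log (1 + lam * W ω) ∂P ≤
        ((∫ ω, W ω ∂P) / 2) *
          min (8 * (∫ ω, W ω ∂P) / (3 * ∫ ω, (W ω) ^ 2 ∂P)) 1) ∧
    (⨆ lam : Set.Icc (-(1 / 2) : ℝ) (1 / 2),
        ∫ ω, Real.log (1 + (lam : ℝ) * W ω) ∂P) ≤
      ((∫ ω, W ω ∂P) / 2) *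
        min (8 * (∫ ω, W ω ∂P) / (3 * ∫ ω, (W ω) ^ 2 ∂P)) 1 := by
  have hbound : ∀ lam ∈ Set.Icc (-(1 / 2) : ℝ) (1 / 2),
      ∫ ω, Real.log (1 + lam * W ω) ∂P ≤
        ((∫ ω, W ω ∂P) / 2) *
          min (8 * (∫ ω, W ω ∂P) / (3 * ∫ ω, (W ω) ^ 2 ∂P)) 1 := by
    intro lam hlam
    refine (integral_log_one_add_mul_le hW hbdd hlam).trans ?_
    generalize ∫ ω, W ω ∂P = m at *
    generalize ∫ ω, (W ω) ^ 2 ∂P = s at *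
    rw [mul_min_of_nonneg _ _ (by linarith)]
    refine le_min ?_ ?_
    · have heq : m / 2 * (8 * m / (3 * s)) = 4 * m ^ 2 / (3 * s) := by
        field_simp
        ring
      rw [heq, le_div_iff₀ (by positivity)]
      nlinarith [sq_nonneg (8 * m - 3 * lam * s)]
    · nlinarith [hlam.2, mul_nonneg (sq_nonneg lam) hsq.le]
  have : Nonempty (Set.Icc (-(1 / 2) : ℝ) (1 / 2)) := ⟨⟨0, by norm_num⟩⟩
  exact ⟨hbound, ciSup_le fun lam => hbound lam lam.2⟩
end

section
/- For every real y ≥ −1 and every λ ∈ [0, 1), log(1 + λy) ≥ λy + y²·(log(1 − λ) + λ). (Inequality of Fan, Grama and Liu used in the proof of Theorem 1, part 2.) -/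
theorem one_add_mul_pos_of_neg_one_le {y t : ℝ} (hy : -1 ≤ y) (ht : t ∈ Set.Ico (0 : ℝ) 1) :
    0 < 1 + t * y := by
  nlinarith [ht.1, ht.2]

theorem hasDerivAt_log_one_add_mul_sub {y t : ℝ} (hy : -1 ≤ y) (ht : t ∈ Set.Ico (0 : ℝ) 1) :
    HasDerivAt (fun s : ℝ => Real.log (1 + s * y) - (s * y + y ^ 2 * (Real.log (1 - s) + s)))
      (t ^ 2 * y ^ 2 * (1 + y) / ((1 + t * y) * (1 - t))) t := by
  have hpos := (one_add_mul_pos_of_neg_one_le hy ht).ne'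
  have hsub : 1 - t ≠ 0 := (sub_pos.2 ht.2).ne'
  have hmul : HasDerivAt (fun s : ℝ => s * y) (1 * y) t := (hasDerivAt_id' t).mul_const y
  have hlog := ((hasDerivAt_id' t).const_sub 1).log hsub
  refine (((hmul.const_add 1).log hpos).sub
    (hmul.add ((hlog.add (hasDerivAt_id' t)).const_mul (y ^ 2)))).congr_deriv ?_
  have hpos' : 1 + y * t ≠ 0 := by rwa [mul_comm y t]
  field_simp
  ring

/-- Inequality of Fan, Grama and Liu used in the proof of Theorem 1, part 2:
for `y ≥ −1` and `λ ∈ [0,1)`, `log(1 + λy) ≥ λy + y²(log(1 − λ) + λ)`. -/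
theorem stmt6 (y lam : ℝ) (hy : -1 ≤ y) (hlam : lam ∈ Set.Ico (0 : ℝ) 1) :
    lam * y + y ^ 2 * (Real.log (1 - lam) + lam) ≤ Real.log (1 + lam * y) := by
  have hmono : MonotoneOn
      (fun s : ℝ => Real.log (1 + s * y) - (s * y + y ^ 2 * (Real.log (1 - s) + s)))
      (Set.Ico 0 1) := by
    refine monotoneOn_of_deriv_nonneg (convex_Ico 0 1)
      (fun t ht => (hasDerivAt_log_one_add_mul_sub hy ht).continuousAt.continuousWithinAt)
      (fun t ht => (hasDerivAt_log_one_add_mul_sub hy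
        (interior_subset ht)).differentiableAt.differentiableWithinAt)
      (fun t ht => ?_)
    have ht' := interior_subset ht
    rw [(hasDerivAt_log_one_add_mul_sub hy ht').deriv]
    have hpos := one_add_mul_pos_of_neg_one_le hy ht'
    have hsub : 0 < 1 - t := sub_pos.2 ht'.2
    have hy' : 0 ≤ 1 + y := by linarith
    positivity
  have h := hmono (Set.left_mem_Ico.2 one_pos) hlam hlam.1
  simp at h
  linarith
end

section
/- Let X₁, X₂ be random variables with values in a measurable space 𝒳 and Y₁, Y₂ be random variables with values in a measurable space 𝒴 on a common probability space, such that the pair (X₁,X₂) is independent of the pair (Y₁,Y₂), and such that (Y₁,Y₂) and (Y₂,Y₁) are identically distributed (or, alternatively, (X₁,X₂) and (X₂,X₁) are identically distributed). Let g : 𝒳 × 𝒴 → ℝ be measurable, and set W = g(X₁,Y₁) + g(X₂,Y₂) − g(X₁,Y₂) − g(X₂,Y₁). Then W and −W are identically distributed, i.e., W is symmetric around zero. (Proposition 4.) -/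
open MeasureTheory ProbabilityTheory

/-- Proposition 4: if `(X₁,X₂) ⟂ (Y₁,Y₂)` and `(Y₁,Y₂)` is exchangeable (or `(X₁,X₂)` is
exchangeable), then `W = g(X₁,Y₁) + g(X₂,Y₂) − g(X₁,Y₂) − g(X₂,Y₁)` is symmetric around
zero, i.e. `W` and `−W` have the same distribution. -/
theorem stmt12
    {Ω 𝒳 𝒴 : Type*} [MeasurableSpace Ω] [MeasurableSpace 𝒳] [MeasurableSpace 𝒴]
    (P : Measure Ω) [IsProbabilityMeasure P]
    (X₁ X₂ : Ω → 𝒳) (Y₁ Y₂ : Ω → 𝒴)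
    (hX₁ : Measurable X₁) (hX₂ : Measurable X₂)
    (hY₁ : Measurable Y₁) (hY₂ : Measurable Y₂)
    (hindep : IndepFun (fun ω => (X₁ ω, X₂ ω)) (fun ω => (Y₁ ω, Y₂ ω)) P)
    (hexch : P.map (fun ω => (Y₁ ω, Y₂ ω)) = P.map (fun ω => (Y₂ ω, Y₁ ω)) ∨
             P.map (fun ω => (X₁ ω, X₂ ω)) = P.map (fun ω => (X₂ ω, X₁ ω)))
    (g : 𝒳 × 𝒴 → ℝ) (hg : Measurable g) :
    P.map (fun ω =>
        g (X₁ ω, Y₁ ω) + g (X₂ ω, Y₂ ω) - g (X₁ ω, Y₂ ω) - g (X₂ ω, Y₁ ω)) =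
    P.map (fun ω =>
        -(g (X₁ ω, Y₁ ω) + g (X₂ ω, Y₂ ω) - g (X₁ ω, Y₂ ω) - g (X₂ ω, Y₁ ω))) := by
  have hX : Measurable fun ω => (X₁ ω, X₂ ω) := hX₁.prodMk hX₂
  have hY : Measurable fun ω => (Y₁ ω, Y₂ ω) := hY₁.prodMk hY₂
  have hw : Measurable fun p : (𝒳 × 𝒳) × (𝒴 × 𝒴) =>
      g (p.1.1, p.2.1) + g (p.1.2, p.2.2) - g (p.1.1, p.2.2) - g (p.1.2, p.2.1) := by
    fun_prop
  rcases hexch with h | h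
  · have hYswap : IdentDistrib (fun ω => (Y₁ ω, Y₂ ω)) (fun ω => (Y₂ ω, Y₁ ω)) P P :=
      ⟨hY.aemeasurable, (hY₂.prodMk hY₁).aemeasurable, h⟩
    have hpair := (IdentDistrib.refl hX.aemeasurable).prodMk hYswap hindep
      (hindep.comp measurable_id measurable_swap)
    refine (hpair.comp hw).map_eq.trans (congrArg (fun f => P.map f) ?_)
    funext ω
    simp only [Function.comp_apply]
    ring
  · have hXswap : IdentDistrib (fun ω => (X₁ ω, X₂ ω)) (fun ω => (X₂ ω, X₁ ω)) P P :=
      ⟨hX.aemeasurable, (hX₂.prodMk hX₁).aemeasurable, h⟩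
    have hpair := hXswap.prodMk (IdentDistrib.refl hY.aemeasurable) hindep
      (hindep.comp measurable_swap measurable_id)
    refine (hpair.comp hw).map_eq.trans (congrArg (fun f => P.map f) ?_)
    funext ω
    simp only [Function.comp_apply]
    ring
end

section
/- Let t ≥ 1 and let f₁, …, f_t be real numbers with |fᵢ| ≤ 1 for all i and ∑_{i=1}^{t} fᵢ² > 0. Set S₁ = ∑_{i=1}^{t} fᵢ, S₂ = ∑_{i=1}^{t} fᵢ², and λ₀ = (1/2)·min(max(S₁/S₂, 0), 1). Then (1/t) ∑_{i=1}^{t} log(1 + λ₀ fᵢ) ≥ (max(S₁/t, 0)/4) · min(S₁/S₂, 1). (Deterministic lower bound on the log-wealth of the clipped empirical-Kelly constant bet, from the proof of Theorem 3, part 2.) -/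
/-- Quadratic lower bound for the logarithm near `1`. -/
lemma sub_sq_le_log_one_add {x : ℝ} (hx : |x| ≤ 1 / 2) : x - x ^ 2 ≤ Real.log (1 + x) := by
  obtain ⟨hl, hu⟩ := abs_le.mp hx
  have hx1 : 0 < 1 + x := by linarith
  rcases le_total 0 x with h0 | h0
  · refine le_trans ?_ (Real.one_sub_inv_le_log_of_pos hx1)
    have key : 1 - (1 + x)⁻¹ - (x - x ^ 2) = x ^ 3 / (1 + x) := by
      field_simp
      ring
    have : 0 ≤ x ^ 3 / (1 + x) := by positivity
    linarith
  · rw [Real.le_log_iff_exp_le hx1, ← neg_sub, Real.exp_neg]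
    refine inv_le_of_inv_le₀ hx1 (le_trans ?_ (Real.quadratic_le_exp_of_nonneg (by nlinarith)))
    rw [inv_le_iff_one_le_mul₀ hx1]
    have hc : 0 ≤ 1 + x - x ^ 2 + x ^ 3 := by nlinarith [mul_nonneg (sq_nonneg x) hx1.le]
    nlinarith [mul_nonneg (sq_nonneg x) hc]

/-- Quadratic lower bound for the log-wealth of a constant bet `c`. -/
lemma mul_sum_sub_sq_mul_sum_sq_le_sum_log {ι : Type*} (s : Finset ι) (f : ι → ℝ) {c : ℝ}
    (hc : |c| ≤ 1 / 2) (hf : ∀ i ∈ s, |f i| ≤ 1) :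
    c * ∑ i ∈ s, f i - c ^ 2 * ∑ i ∈ s, f i ^ 2 ≤ ∑ i ∈ s, Real.log (1 + c * f i) := by
  rw [Finset.mul_sum, Finset.mul_sum, ← Finset.sum_sub_distrib]
  refine Finset.sum_le_sum fun i hi => ?_
  rw [← mul_pow]
  refine sub_sq_le_log_one_add ?_
  rw [abs_mul]
  nlinarith [hf i hi, abs_nonneg c, abs_nonneg (f i)]

/-- Deterministic lower bound on the log-wealth of the clipped empirical-Kelly constant bet
(from the proof of Theorem 3, part 2): for `|fᵢ| ≤ 1` with `S₂ = ∑ fᵢ² > 0`,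
`S₁ = ∑ fᵢ` and `λ₀ = (1/2)·min(max(S₁/S₂, 0), 1)`,
`(1/t) ∑ log(1 + λ₀ fᵢ) ≥ (max(S₁/t, 0)/4) · min(S₁/S₂, 1)`. -/
theorem stmt15 (t : ℕ) (ht : 1 ≤ t) (f : ℕ → ℝ)
    (hbdd : ∀ i ∈ Finset.Icc 1 t, |f i| ≤ 1)
    (hpos : 0 < ∑ i ∈ Finset.Icc 1 t, f i ^ 2) :
    max ((∑ i ∈ Finset.Icc 1 t, f i) / (t : ℝ)) 0 / 4 *
        min ((∑ i ∈ Finset.Icc 1 t, f i) / (∑ i ∈ Finset.Icc 1 t, f i ^ 2)) 1 ≤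
      (1 / (t : ℝ)) *
        ∑ i ∈ Finset.Icc 1 t,
          Real.log (1 +
            (1 / 2 *
              min (max ((∑ j ∈ Finset.Icc 1 t, f j) / (∑ j ∈ Finset.Icc 1 t, f j ^ 2)) 0) 1) *
            f i) := by
  have htpos : (0 : ℝ) < t := by exact_mod_cast ht
  rcases le_or_gt (∑ i ∈ Finset.Icc 1 t, f i) 0 with hS | hS
  · rw [max_eq_right (div_nonpos_of_nonpos_of_nonneg hS htpos.le),
      max_eq_right (div_nonpos_of_nonpos_of_nonneg hS hpos.le)]
    simp
  · rw [max_eq_left (div_pos hS htpos).le, max_eq_left (div_pos hS hpos).le]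
    set S₁ := ∑ i ∈ Finset.Icc 1 t, f i
    set S₂ := ∑ i ∈ Finset.Icc 1 t, f i ^ 2
    set m := min (S₁ / S₂) 1
    have hm0 : 0 ≤ m := le_min (div_pos hS hpos).le zero_le_one
    have hm1 : m ≤ 1 := min_le_right _ _
    have hmS : m * S₂ ≤ S₁ := (le_div_iff₀ hpos).mp (min_le_left _ _)
    have hlog := mul_sum_sub_sq_mul_sum_sq_le_sum_log (Finset.Icc 1 t) f (c := 1 / 2 * m)
      (by rw [abs_of_nonneg (by positivity)]; linarith) hbdd
    calc S₁ / t / 4 * m = 1 / t * (m * S₁ / 4) := by ring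
      _ ≤ 1 / t * (1 / 2 * m * S₁ - (1 / 2 * m) ^ 2 * S₂) := by
        gcongr
        nlinarith [mul_le_mul_of_nonneg_left hmS hm0]
      _ ≤ _ := by gcongr
end
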